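/- Let G be a finite simple bipartite graph with nonempty partite sets U and W, having at least one edge, and let Δ_U denote the maximum degree of a vertex from U. Then M(G) ≤ λmax(G) ≤ √((log Δ_U + 1)·((1/4)·log|W| + 1))·M(G). -/

import Mathlib

-- `lamMax G`: the largest eigenvalue of the adjacency matrix of `G`.
open Classical in
noncomputable def lamMax {V : Type*} [Fintype V] (G : SimpleGraph V) : ℝ :=
  sSup (spectrum ℝ (G.adjMatrix ℝ))

-- `eXY G X Y = e(X,Y)`: the number of ordered pairs `(x,y) ∈ X × Y` with `x` adjacent to `y`.
open Classical in
noncomputable def eXY {V : Type*} (G : SimpleGraph V) (X Y : Finset V) : ℕ :=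
  ((X ×ˢ Y).filter fun p => G.Adj p.1 p.2).card

/-- `M(G)`: the maximum of `e(X,Y)/√(|X||Y|)` over nonempty `X, Y ⊆ V`. -/
noncomputable def MG {V : Type*} (G : SimpleGraph V) : ℝ :=
  sSup {r : ℝ | ∃ X Y : Finset V, X.Nonempty ∧ Y.Nonempty ∧
    r = (eXY G X Y : ℝ) / Real.sqrt ((X.card : ℝ) * (Y.card : ℝ))}

open Finset in
theorem sum_sq_le_mul_harmonic {α : Type*} (U : Finset α) (d : α → ℕ) (D : ℕ) (C : ℝ)
    (hC : 0 ≤ C) (hD : ∀ u ∈ U, d u ≤ D)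
    (h : ∀ X ⊆ U, (∑ u ∈ X, (d u : ℝ)) ^ 2 ≤ C * #X) :
    ∑ u ∈ U, (d u : ℝ) ^ 2 ≤ C * harmonic D := by
  have layer : ∑ u ∈ U, (d u : ℝ) ^ 2 =
      ∑ k ∈ range D, ∑ u ∈ U with k < d u, (d u : ℝ) := by
    simp_rw [sum_filter]
    rw [sum_comm]
    refine sum_congr rfl fun u hu => ?_
    rw [← sum_filter, sum_const, nsmul_eq_mul, sq]
    have : (range D).filter (fun k => k < d u) = range (d u) := by
      ext k
      have := hD u hu
      simp only [mem_filter, mem_range]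
      omega
    rw [this, card_range]
  rw [layer, harmonic, Rat.cast_sum, mul_sum]
  refine sum_le_sum fun k _ => ?_
  set X := U.filter (fun u => k < d u) with hX
  set S := ∑ u ∈ X, (d u : ℝ) with hS
  have h1 : ((k : ℝ) + 1) * #X ≤ S := by
    rw [mul_comm, ← nsmul_eq_mul]
    refine card_nsmul_le_sum _ _ _ fun u hu => ?_
    have : k + 1 ≤ d u := (mem_filter.1 hu).2
    exact_mod_cast this
  have h2 : S ^ 2 ≤ C * #X := h X (filter_subset _ _)
  push_cast
  rw [← div_eq_mul_inv, le_div_iff₀ (by positivity)]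
  have hk : (0 : ℝ) < k + 1 := by positivity
  have h0 : 0 ≤ S := le_trans (by positivity) h1
  rcases h0.eq_or_lt with h0 | h0
  · rw [← h0]; simpa using hC
  · refine le_of_mul_le_mul_right ?_ h0
    nlinarith [mul_le_mul_of_nonneg_left h1 hC]

theorem sq_sqrt_succ_sub_sqrt_le (n : ℕ) (hn : 1 ≤ n) :
    (√((n : ℝ) + 1) - √n) ^ 2 ≤ 1 / 4 * (Real.log (n + 1) - Real.log n) := by
  have hn' : (0 : ℝ) < n := by exact_mod_cast hn
  set s := √((n : ℝ) + 1) with hs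
  set t := √(n : ℝ) with ht
  have hs0 : 0 < s := Real.sqrt_pos.2 (by linarith)
  have ht0 : 0 < t := Real.sqrt_pos.2 hn'
  have hs2 : s ^ 2 = n + 1 := Real.sq_sqrt (by linarith)
  have ht2 : t ^ 2 = n := Real.sq_sqrt hn'.le
  have hts : t ≤ s := Real.sqrt_le_sqrt (by linarith)
  have key := Real.le_log_one_add_of_nonneg (x := s / t - 1)
    (by rw [sub_nonneg, one_le_div ht0]; exact hts)
  rw [add_sub_cancel, Real.log_div hs0.ne' ht0.ne', hs, ht, Real.log_sqrt (by linarith),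
    Real.log_sqrt hn'.le, ← hs, ← ht] at key
  have e : 2 * (s / t - 1) / (s / t - 1 + 2) = 2 * (s - t) ^ 2 := by
    have : s / t - 1 + 2 = (s + t) / t := by field_simp; ring
    rw [this]
    field_simp
    have : (s - t) * (s + t) = 1 := by nlinarith
    linear_combination (-(s - t)) * this
  linarith

open Finset in
theorem sum_sq_sqrt_succ_sub_sqrt_le (n : ℕ) (hn : 1 ≤ n) :
    ∑ i ∈ range n, (√((i : ℝ) + 1) - √i) ^ 2 ≤ 1 / 4 * Real.log n + 1 := by
  induction n, hn using Nat.le_induction with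
  | base => simp
  | succ n hn ih =>
    rw [sum_range_succ]
    push_cast
    linarith [sq_sqrt_succ_sub_sqrt_le n hn]

open Finset in
theorem sum_sq_add_le_of_sum_le_sqrt_card {α : Type*} (c : α → ℝ) (K : ℝ)
    (S : Finset α) : (∀ Y ⊆ S, ∑ w ∈ Y, c w ≤ K * √(#Y)) → ∀ m : ℝ, (∀ w ∈ S, m ≤ c w) →
    ∑ w ∈ S, c w ^ 2 + 2 * m * (K * √(#S) - ∑ w ∈ S, c w) ≤
      K ^ 2 * ∑ i ∈ range #S, (√((i : ℝ) + 1) - √i) ^ 2 := by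
  classical
  induction S using Finset.induction_on_min_value c with
  | empty => simp
  | insert a s ha hmin ih =>
    intro h m hm
    have ih' := ih (fun Y hY => h Y (hY.trans (subset_insert _ _))) (c a) hmin
    have hfull := h _ subset_rfl
    have hma := hm a (mem_insert_self _ _)
    rw [sum_insert ha, card_insert_of_notMem ha] at *
    rw [sum_insert ha, sum_range_succ, mul_add]
    push_cast at *
    nlinarith [sq_nonneg (c a - K * (√((#s : ℝ) + 1) - √(#s))),
      mul_nonneg (sub_nonneg.2 hma) (sub_nonneg.2 hfull)]

open Finset in
theorem sum_sq_le_of_sum_le_sqrt_card {α : Type*} (c : α → ℝ) (K : ℝ) (S : Finset α)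
    (hS : S.Nonempty) (hc : ∀ w ∈ S, 0 ≤ c w) (h : ∀ Y ⊆ S, ∑ w ∈ Y, c w ≤ K * √(#Y)) :
    ∑ w ∈ S, c w ^ 2 ≤ K ^ 2 * (1 / 4 * Real.log #S + 1) := by
  have h1 := sum_sq_add_le_of_sum_le_sqrt_card c K S h 0 hc
  have h2 := mul_le_mul_of_nonneg_left (sum_sq_sqrt_succ_sub_sqrt_le #S hS.card_pos) (sq_nonneg K)
  linarith

open Matrix in
theorem dotProduct_mulVec_le_of_spectrum_le {V : Type*} [Fintype V] [DecidableEq V]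
    {A : Matrix V V ℝ} (hA : A.IsHermitian) (l : ℝ) (hl : ∀ μ ∈ spectrum ℝ A, μ ≤ l)
    (z : V → ℝ) : z ⬝ᵥ A *ᵥ z ≤ l * (z ⬝ᵥ z) := by
  have hpsd : (algebraMap ℝ (Matrix V V ℝ) l - A).PosSemidef := by
    rw [posSemidef_iff_isHermitian_and_spectrum_nonneg]
    refine ⟨IsHermitian.sub ?_ hA, ?_⟩
    · rw [algebraMap_eq_diagonal]
      exact isHermitian_diagonal _
    · rw [← spectrum.singleton_sub_eq]
      rintro _ ⟨_, rfl, μ, hμ, rfl⟩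
      exact sub_nonneg.2 (hl μ hμ)
  have h := hpsd.dotProduct_mulVec_nonneg z
  rw [Algebra.algebraMap_eq_smul_one, sub_mulVec, smul_mulVec, one_mulVec, dotProduct_sub,
    dotProduct_smul, smul_eq_mul, star_trivial] at h
  linarith

open Matrix in
theorem exists_mulVec_eq_smul_of_mem_spectrum {V : Type*} [Fintype V] [DecidableEq V]
    {A : Matrix V V ℝ} {l : ℝ} (hl : l ∈ spectrum ℝ A) : ∃ z ≠ 0, A *ᵥ z = l • z := by
  rw [← spectrum_toLin', ← Module.End.hasEigenvalue_iff_mem_spectrum] at hl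
  obtain ⟨z, hz⟩ := hl.exists_hasEigenvector
  exact ⟨z, hz.2, by simpa using hz.apply_eq_smul⟩

open Matrix in
theorem dotProduct_mulVec_le_of_nonneg {V : Type*} [Fintype V]
    {A : Matrix V V ℝ} (hA : A.IsSymm) (h0 : ∀ i j, 0 ≤ A i j) (l : ℝ)
    (hl : ∀ z, z ⬝ᵥ A *ᵥ z ≤ l * (z ⬝ᵥ z)) (x y : V → ℝ) :
    2 * (x ⬝ᵥ A *ᵥ y) ≤ l * (x ⬝ᵥ x + y ⬝ᵥ y) := by
  have habs (z : V → ℝ) : -(z ⬝ᵥ A *ᵥ z) ≤ l * (z ⬝ᵥ z) := by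
    have h := hl |z|
    have e : |z| ⬝ᵥ |z| = z ⬝ᵥ z := by simp [dotProduct]
    rw [e] at h
    refine le_trans ?_ h
    simp only [dotProduct, mulVec, Finset.mul_sum, ← Finset.sum_neg_distrib]
    refine Finset.sum_le_sum fun i _ => Finset.sum_le_sum fun j _ => ?_
    refine (neg_le_abs _).trans_eq ?_
    simp [abs_mul, abs_of_nonneg (h0 i j)]
  have hsymm : y ⬝ᵥ A *ᵥ x = x ⬝ᵥ A *ᵥ y := by
    rw [dotProduct_mulVec, ← mulVec_transpose, hA.eq, dotProduct_comm]
  have h1 := hl (x + y)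
  have h2 := habs (x - y)
  simp only [mulVec_add, mulVec_sub, dotProduct_add, dotProduct_sub, add_dotProduct,
    sub_dotProduct, dotProduct_comm y x, hsymm] at h1 h2
  linarith

open Classical Finset in
theorem eXY_eq_sum {V : Type*} [Fintype V] (G : SimpleGraph V) (X Y : Finset V) :
    eXY G X Y = ∑ x ∈ X, #{y ∈ Y | G.Adj x y} := by
  unfold eXY
  rw [card_filter, sum_product]
  simp_rw [card_filter]

open Classical Matrix Finset in
theorem eXY_eq_dotProduct {V : Type*} [Fintype V] (G : SimpleGraph V) (X Y : Finset V) :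
    (eXY G X Y : ℝ) = (fun v => if v ∈ X then (1 : ℝ) else 0) ⬝ᵥ
      G.adjMatrix ℝ *ᵥ (fun v => if v ∈ Y then (1 : ℝ) else 0) := by
  simp only [eXY_eq_sum, dotProduct, mulVec, SimpleGraph.adjMatrix_apply, card_filter, ite_mul,
    mul_ite, one_mul, mul_one, zero_mul, mul_zero, sum_ite_mem, univ_inter]
  push_cast
  rfl

open Classical in
theorem le_lamMax {V : Type*} [Fintype V] (G : SimpleGraph V) :
    ∀ μ ∈ spectrum ℝ (G.adjMatrix ℝ), μ ≤ lamMax G :=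
  fun _ hμ => le_csSup (G.adjMatrix ℝ).finite_real_spectrum.bddAbove hμ

open Classical in
theorem lamMax_mem_spectrum {V : Type*} [Fintype V] [Nonempty V] (G : SimpleGraph V) :
    lamMax G ∈ spectrum ℝ (G.adjMatrix ℝ) :=
  Set.Nonempty.csSup_mem
    ⟨_, (G.isHermitian_adjMatrix ℝ).eigenvalues_mem_spectrum_real (Classical.arbitrary V)⟩
    (G.adjMatrix ℝ).finite_real_spectrum

open Classical Matrix in
theorem eXY_div_le_lamMax {V : Type*} [Fintype V] (G : SimpleGraph V) {X Y : Finset V}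
    (hX : X.Nonempty) (hY : Y.Nonempty) :
    (eXY G X Y : ℝ) / √((X.card : ℝ) * (Y.card : ℝ)) ≤ lamMax G := by
  have hp : (0 : ℝ) < X.card := by exact_mod_cast hX.card_pos
  have hq : (0 : ℝ) < Y.card := by exact_mod_cast hY.card_pos
  have hpos : 0 < √((X.card : ℝ) * (Y.card : ℝ)) := Real.sqrt_pos.2 (by positivity)
  rw [div_le_iff₀ hpos]
  have h := dotProduct_mulVec_le_of_nonneg G.isSymm_adjMatrix
    (fun i j => by rw [SimpleGraph.adjMatrix_apply]; split_ifs <;> norm_num) (lamMax G)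
    (dotProduct_mulVec_le_of_spectrum_le (G.isHermitian_adjMatrix ℝ) _ (le_lamMax G))
    (√(Y.card : ℝ) • fun v => if v ∈ X then (1 : ℝ) else 0)
    (√(X.card : ℝ) • fun v => if v ∈ Y then (1 : ℝ) else 0)
  rw [mulVec_smul, smul_dotProduct, dotProduct_smul, ← eXY_eq_dotProduct] at h
  have hsq (Z : Finset V) : (fun v => if v ∈ Z then (1 : ℝ) else 0) ⬝ᵥ
      (fun v => if v ∈ Z then (1 : ℝ) else 0) = Z.card := by
    simp [dotProduct]
  simp only [smul_dotProduct, dotProduct_smul, smul_eq_mul, hsq] at h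
  rw [Real.sqrt_mul hp.le] at hpos ⊢
  refine le_of_mul_le_mul_right ?_ hpos
  have e1 := Real.mul_self_sqrt hp.le
  have e2 := Real.mul_self_sqrt hq.le
  generalize √(X.card : ℝ) = s at *
  generalize √(Y.card : ℝ) = t at *
  rw [← e1, ← e2] at h
  linarith

theorem MG_nonneg {V : Type*} [Fintype V] (G : SimpleGraph V) : 0 ≤ MG G := by
  refine Real.sSup_nonneg ?_
  rintro _ ⟨X, Y, -, -, rfl⟩
  positivity

theorem eXY_le_MG_mul {V : Type*} [Fintype V] (G : SimpleGraph V) (X Y : Finset V) :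
    (eXY G X Y : ℝ) ≤ MG G * √((X.card : ℝ) * (Y.card : ℝ)) := by
  rcases X.eq_empty_or_nonempty with rfl | hX
  · simp [eXY]
  rcases Y.eq_empty_or_nonempty with rfl | hY
  · simp [eXY]
  have hp : (0 : ℝ) < X.card := by exact_mod_cast hX.card_pos
  have hq : (0 : ℝ) < Y.card := by exact_mod_cast hY.card_pos
  rw [← div_le_iff₀ (Real.sqrt_pos.2 (by positivity))]
  refine le_csSup ⟨lamMax G, ?_⟩ ⟨X, Y, hX, hY, rfl⟩
  rintro _ ⟨X, Y, hX, hY, rfl⟩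
  exact eXY_div_le_lamMax G hX hY

theorem MG_le_lamMax {V : Type*} [Fintype V] [Nonempty V] (G : SimpleGraph V) :
    MG G ≤ lamMax G := by
  have v := Classical.arbitrary V
  refine csSup_le ⟨_, {v}, {v}, by simp, by simp, rfl⟩ ?_
  rintro _ ⟨X, Y, hX, hY, rfl⟩
  exact eXY_div_le_lamMax G hX hY

open Classical Finset in
theorem sum_sq_card_filter_adj_le {V : Type*} [Fintype V] (G : SimpleGraph V)
    (U Y : Finset V) (D : ℕ) (hD : ∀ u ∈ U, G.degree u ≤ D) :
    ∑ u ∈ U, (#{y ∈ Y | G.Adj u y} : ℝ) ^ 2 ≤ MG G ^ 2 * #Y * (Real.log D + 1) := by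
  have hC : 0 ≤ MG G ^ 2 * #Y := by positivity
  refine (sum_sq_le_mul_harmonic U _ D _ hC (fun u hu => le_trans ?_ (hD u hu)) ?_).trans ?_
  · rw [← G.card_neighborFinset_eq_degree]
    exact card_le_card fun y hy => by simpa using (mem_filter.1 hy).2
  · intro X _
    have h := eXY_le_MG_mul G X Y
    rw [eXY_eq_sum, Nat.cast_sum] at h
    calc _ ≤ (MG G * √((#X : ℝ) * #Y)) ^ 2 := pow_le_pow_left₀ (by positivity) h 2
      _ = MG G ^ 2 * #Y * #X := by rw [mul_pow, Real.sq_sqrt (by positivity)]; ring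
  · have := harmonic_le_one_add_log D
    gcongr
    linarith

open Classical Finset in
theorem lamMax_sq_mul_sum_sq_le {V : Type*} [Fintype V] (G : SimpleGraph V)
    (U W : Finset V) (hW : W.Nonempty) (D : ℕ) (hD : ∀ u ∈ U, G.degree u ≤ D)
    (l : ℝ) (z : V → ℝ) (hl : 0 ≤ l)
    (hz : ∀ w ∈ W, l * z w = ∑ u ∈ U, if G.Adj u w then z u else 0) :
    l ^ 2 * ∑ w ∈ W, z w ^ 2 ≤
      (Real.log D + 1) * (1 / 4 * Real.log #W + 1) * MG G ^ 2 * ∑ u ∈ U, z u ^ 2 := by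
  have hlog : 0 ≤ Real.log D := Real.log_natCast_nonneg D
  have hN : 0 ≤ ∑ u ∈ U, z u ^ 2 := sum_nonneg fun _ _ => sq_nonneg _
  set c : V → ℝ := fun w => ∑ u ∈ U, if G.Adj u w then |z u| else 0 with hc
  have hcz : ∀ w ∈ W, l * |z w| ≤ c w := by
    intro w hw
    rw [← abs_of_nonneg hl, ← abs_mul, hz w hw]
    refine (abs_sum_le_sum_abs _ _).trans (sum_le_sum fun u _ => ?_)
    split_ifs <;> simp
  have hsum : ∀ Y ⊆ W, ∑ w ∈ Y, c w ≤
      √(MG G ^ 2 * (Real.log D + 1) * ∑ u ∈ U, z u ^ 2) * √(#Y) := by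
    intro Y _
    rw [← Real.sqrt_mul (by positivity)]
    refine Real.le_sqrt_of_sq_le ?_
    have e : ∑ w ∈ Y, c w = ∑ u ∈ U, |z u| * #{y ∈ Y | G.Adj u y} := by
      rw [sum_comm]
      refine sum_congr rfl fun u _ => ?_
      rw [← sum_filter, sum_const, nsmul_eq_mul, mul_comm]
    rw [e]
    refine (sum_mul_sq_le_sq_mul_sq _ _ _).trans ?_
    simp_rw [sq_abs]
    refine (mul_le_mul_of_nonneg_left (sum_sq_card_filter_adj_le G U Y D hD) hN).trans_eq ?_
    ring
  have key := sum_sq_le_of_sum_le_sqrt_card c _ W hW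
    (fun w _ => sum_nonneg fun u _ => by split_ifs <;> simp) hsum
  rw [Real.sq_sqrt (by positivity)] at key
  calc l ^ 2 * ∑ w ∈ W, z w ^ 2 = ∑ w ∈ W, (l * |z w|) ^ 2 := by
        simp_rw [mul_pow, sq_abs, mul_sum]
    _ ≤ ∑ w ∈ W, c w ^ 2 := sum_le_sum fun w hw =>
        pow_le_pow_left₀ (by positivity) (hcz w hw) 2
    _ ≤ _ := key
    _ = _ := by ring

open Classical Finset in
theorem mul_eq_sum_of_adjMatrix_mulVec_eq {V : Type*} [Fintype V] (G : SimpleGraph V)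
    {U : Finset V} {l : ℝ} {z : V → ℝ} (hz : (G.adjMatrix ℝ).mulVec z = l • z) {w : V}
    (hw : ∀ u, G.Adj u w → u ∈ U) :
    l * z w = ∑ u ∈ U, if G.Adj u w then z u else 0 := by
  have h := congrFun hz w
  rw [SimpleGraph.adjMatrix_mulVec_apply, Pi.smul_apply, smul_eq_mul] at h
  rw [← h, ← sum_filter]
  refine sum_congr ?_ fun _ _ => rfl
  ext u
  simpa [G.adj_comm w u] using hw u

/-- Theorem 2′: for a bipartite graph with partite sets `U`, `W`, with at least one edge,
and `Δ_U` the maximum degree of a vertex from `U`,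
`M(G) ≤ λmax(G) ≤ √((log Δ_U + 1)·((1/4)·log|W| + 1))·M(G)`. -/
theorem statement9 {V : Type*} [Fintype V] (G : SimpleGraph V) [DecidableRel G.Adj]
    (U W : Finset V) (hU : U.Nonempty) (hW : W.Nonempty)
    (hdisj : Disjoint U W) (hcover : ∀ v : V, v ∈ U ∨ v ∈ W)
    (hbip : ∀ a b, G.Adj a b → (a ∈ U ∧ b ∈ W) ∨ (a ∈ W ∧ b ∈ U))
    (hedge : ∃ a b, G.Adj a b) :
    MG G ≤ lamMax G ∧
      lamMax G ≤ Real.sqrt ((Real.log (U.sup' hU fun u => (G.degree u : ℝ)) + 1) *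
        ((1 / 4 : ℝ) * Real.log (W.card : ℝ) + 1)) * MG G := by
  classical
  have hV : Nonempty V := ⟨hU.choose⟩
  refine ⟨MG_le_lamMax G, ?_⟩
  obtain ⟨u₀, -, hu₀⟩ := U.exists_mem_eq_sup' hU fun u => (G.degree u : ℝ)
  have hD : ∀ u ∈ U, G.degree u ≤ G.degree u₀ := fun u hu => by
    have := U.le_sup' (fun u => (G.degree u : ℝ)) hu
    rw [hu₀] at this
    exact_mod_cast this
  rw [hu₀]
  rcases le_or_gt (lamMax G) 0 with hl | hl
  · exact hl.trans (mul_nonneg (Real.sqrt_nonneg _) (MG_nonneg G))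
  obtain ⟨z, hz0, hz⟩ := exists_mulVec_eq_smul_of_mem_spectrum (lamMax_mem_spectrum G)
  have hzW : ∀ w ∈ W, lamMax G * z w = ∑ u ∈ U, if G.Adj u w then z u else 0 := fun w hw => by
    convert mul_eq_sum_of_adjMatrix_mulVec_eq G (U := U) (w := w) (by convert hz) fun u h =>
      ((hbip u w h).resolve_right fun h' => Finset.disjoint_left.1 hdisj h'.2 hw).1
  have hzU : ∀ u ∈ U, lamMax G * z u = ∑ w ∈ W, if G.Adj w u then z w else 0 := fun u hu => by
    convert mul_eq_sum_of_adjMatrix_mulVec_eq G (U := W) (w := u) (by convert hz) fun w h =>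
      ((hbip w u h).resolve_left fun h' => Finset.disjoint_left.1 hdisj hu h'.2).1
  have hsum : ∑ w ∈ W, z w ^ 2 = ∑ u ∈ U, z u ^ 2 := by
    refine mul_left_cancel₀ hl.ne' ?_
    calc lamMax G * ∑ w ∈ W, z w ^ 2
        = ∑ w ∈ W, ∑ u ∈ U, if G.Adj u w then z u * z w else 0 := by
          rw [Finset.mul_sum]
          refine Finset.sum_congr rfl fun w hw => ?_
          rw [sq, ← mul_assoc, hzW w hw, Finset.sum_mul]
          simp
      _ = lamMax G * ∑ u ∈ U, z u ^ 2 := by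
          rw [Finset.mul_sum, Finset.sum_comm]
          refine Finset.sum_congr rfl fun u hu => ?_
          rw [sq, ← mul_assoc, hzU u hu, Finset.sum_mul]
          simp [G.adj_comm u, mul_comm]
  have hpos : 0 < ∑ u ∈ U, z u ^ 2 := by
    obtain ⟨v, hv⟩ := Function.ne_iff.1 hz0
    have hv2 : 0 < z v ^ 2 := sq_pos_of_ne_zero hv
    rcases hcover v with h | h
    · exact hv2.trans_le (Finset.single_le_sum (fun i _ => sq_nonneg (z i)) h)
    · rw [← hsum]
      exact hv2.trans_le (Finset.single_le_sum (fun i _ => sq_nonneg (z i)) h)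
  have key := lamMax_sq_mul_sum_sq_le G U W hW (G.degree u₀)
    (fun u hu => by convert hD u hu) (lamMax G) z hl.le (fun w hw => by convert hzW w hw)
  rw [hsum] at key
  have hsq := le_of_mul_le_mul_right key hpos
  have := Real.le_sqrt_of_sq_le hsq
  rwa [Real.sqrt_mul' _ (sq_nonneg _), Real.sqrt_sq (MG_nonneg G)] at this
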